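/- arXiv:1903.10209 — 3 statements merged into one kernel-verified Lean document; each statement's English description precedes it below -/
import Mathlib

section
/- For all w₁, w₂, h₁, h₂ ∈ ZMod ℓ, the state produced by the two servers in the QPIR protocol equals a phase times a Weyl-shifted maximally entangled state: (W(w₁+h₁, w₂+h₂) ⊗ conj(W(h₁,h₂))) |Φ⟩ = ω^{−w₂·h₁} · (W(w₁,w₂) ⊗ I)|Φ⟩, where conj denotes entrywise complex conjugation. -/
open Matrix Complex

/-- The primitive `ℓ`-th root of unity `ω = exp(2πi/ℓ)`. -/
noncomputable def omegaRoot (ℓ : ℕ) : ℂ := Complex.exp (2 * Real.pi * Complex.I / ℓ)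

/-- `ω^c` for `c : ZMod ℓ`, via any integer representative (well-defined since `ω^ℓ = 1`). -/
noncomputable def omegaPow (ℓ : ℕ) (c : ZMod ℓ) : ℂ := omegaRoot ℓ ^ c.val

/-- The shift matrix `X` with entries `X_{i,j} = δ_{i, j+1}`. -/
def Xmat (ℓ : ℕ) : Matrix (ZMod ℓ) (ZMod ℓ) ℂ :=
  Matrix.of fun i j => if i = j + 1 then 1 else 0

/-- The phase matrix `Z` with entries `Z_{i,j} = ω^i δ_{i,j}`. -/
noncomputable def Zmat (ℓ : ℕ) : Matrix (ZMod ℓ) (ZMod ℓ) ℂ :=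
  Matrix.diagonal fun i => omegaPow ℓ i

/-- The discrete Weyl operator `W(a,b) = X^a Z^b`. -/
noncomputable def Wmat (ℓ : ℕ) [NeZero ℓ] (a b : ZMod ℓ) : Matrix (ZMod ℓ) (ZMod ℓ) ℂ :=
  Xmat ℓ ^ a.val * Zmat ℓ ^ b.val

/-- Kronecker product of two `ℓ×ℓ` matrices, acting on `ℂ^{(ZMod ℓ)×(ZMod ℓ)}`:
`(A⊗B)_{(i,j),(i',j')} = A_{i,i'} B_{j,j'}`. -/
def kron {ι : Type*} (A B : Matrix ι ι ℂ) : Matrix (ι × ι) (ι × ι) ℂ :=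
  Matrix.of fun p q => A p.1 q.1 * B p.2 q.2

/-- The maximally entangled vector `|Φ⟩`, with `Φ(i,j) = δ_{i,j}/√ℓ`. -/
noncomputable def Phi (ℓ : ℕ) : ZMod ℓ × ZMod ℓ → ℂ :=
  fun p => if p.1 = p.2 then (Real.sqrt ℓ : ℂ)⁻¹ else 0

theorem omegaRoot_pow_self (ℓ : ℕ) [NeZero ℓ] : omegaRoot ℓ ^ ℓ = 1 :=
  (Complex.isPrimitiveRoot_exp ℓ (NeZero.ne ℓ)).pow_eq_one

theorem omegaPow_natCast (ℓ : ℕ) [NeZero ℓ] (n : ℕ) : omegaPow ℓ n = omegaRoot ℓ ^ n := by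
  rw [omegaPow, ZMod.val_natCast, ← pow_eq_pow_mod n (omegaRoot_pow_self ℓ)]

theorem omegaPow_add (ℓ : ℕ) [NeZero ℓ] (a b : ZMod ℓ) :
    omegaPow ℓ (a + b) = omegaPow ℓ a * omegaPow ℓ b := by
  rw [omegaPow, ZMod.val_add, ← pow_eq_pow_mod _ (omegaRoot_pow_self ℓ), pow_add, omegaPow,
    omegaPow]

theorem omegaPow_pow_val (ℓ : ℕ) [NeZero ℓ] (a b : ZMod ℓ) :
    omegaPow ℓ a ^ b.val = omegaPow ℓ (a * b) := by
  rw [omegaPow, ← pow_mul, ← omegaPow_natCast, Nat.cast_mul, ZMod.natCast_zmod_val,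
    ZMod.natCast_zmod_val]

theorem norm_omegaPow (ℓ : ℕ) [NeZero ℓ] (c : ZMod ℓ) : ‖omegaPow ℓ c‖ = 1 := by
  rw [omegaPow, norm_pow, Complex.norm_eq_one_of_pow_eq_one (omegaRoot_pow_self ℓ) (NeZero.ne ℓ),
    one_pow]

theorem conj_omegaPow (ℓ : ℕ) [NeZero ℓ] (c : ZMod ℓ) :
    starRingEnd ℂ (omegaPow ℓ c) = omegaPow ℓ (-c) := by
  rw [← Complex.inv_eq_conj (norm_omegaPow ℓ c)]
  refine inv_eq_of_mul_eq_one_right ?_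
  rw [← omegaPow_add, add_neg_cancel, omegaPow, ZMod.val_zero, pow_zero]

theorem Xmat_pow_apply (ℓ : ℕ) [NeZero ℓ] (n : ℕ) (i j : ZMod ℓ) :
    (Xmat ℓ ^ n) i j = if i = j + n then 1 else 0 := by
  induction n generalizing j with
  | zero => simp [Matrix.one_apply]
  | succ n ih =>
    have hX (k : ZMod ℓ) : Xmat ℓ k j = if k = j + 1 then 1 else 0 := rfl
    simp only [pow_succ, Matrix.mul_apply, hX, mul_ite, mul_one, mul_zero, Finset.sum_ite_eq',
      Finset.mem_univ, if_true, ih, Nat.cast_succ, add_assoc, add_comm (1 : ZMod ℓ)]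

theorem Wmat_apply (ℓ : ℕ) [NeZero ℓ] (a b i j : ZMod ℓ) :
    Wmat ℓ a b i j = if i = j + a then omegaPow ℓ (j * b) else 0 := by
  rw [Wmat, Zmat, Matrix.diagonal_pow, Matrix.mul_diagonal, Xmat_pow_apply, ZMod.natCast_zmod_val,
    Pi.pow_apply, omegaPow_pow_val, ite_mul, one_mul, zero_mul]

theorem kron_mulVec_Phi (ℓ : ℕ) [NeZero ℓ] (A B : Matrix (ZMod ℓ) (ZMod ℓ) ℂ) (i j : ZMod ℓ) :
    (kron A B *ᵥ Phi ℓ) (i, j) = (∑ k, A i k * B j k) * (Real.sqrt ℓ : ℂ)⁻¹ := by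
  simp [Matrix.mulVec, dotProduct, kron, Phi, Fintype.sum_prod_type, Finset.sum_mul]

/-- The state produced by the two servers equals a phase times a Weyl-shifted maximally
entangled state:
`(W(w₁+h₁, w₂+h₂) ⊗ conj(W(h₁,h₂)))|Φ⟩ = ω^{−w₂ h₁} (W(w₁,w₂) ⊗ I)|Φ⟩`. -/
theorem qpir_server_state (ℓ : ℕ) [NeZero ℓ] (hℓ : 2 ≤ ℓ) (w₁ w₂ h₁ h₂ : ZMod ℓ) :
    (kron (Wmat ℓ (w₁ + h₁) (w₂ + h₂)) ((Wmat ℓ h₁ h₂).map (starRingEnd ℂ))) *ᵥ Phi ℓ =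
      omegaPow ℓ (-(w₂ * h₁)) • ((kron (Wmat ℓ w₁ w₂) 1) *ᵥ Phi ℓ) := by
  ext ⟨i, j⟩
  rw [Pi.smul_apply, smul_eq_mul, kron_mulVec_Phi, kron_mulVec_Phi, ← mul_assoc,
    Finset.sum_eq_single (j - h₁), Finset.sum_eq_single j]
  · have hij : i = j - h₁ + (w₁ + h₁) ↔ i = j + w₁ := by
      rw [show j - h₁ + (w₁ + h₁) = j + w₁ by ring]
    simp only [Matrix.map_apply, Wmat_apply, sub_add_cancel, if_true, Matrix.one_apply_eq, mul_one,
      conj_omegaPow, hij, ite_mul, mul_ite, mul_zero, zero_mul, ← omegaPow_add]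
    congr 3
    ring
  · intro k _ hk
    rw [Matrix.one_apply_ne hk.symm, mul_zero]
  · simp
  · intro k _ hk
    rw [Matrix.map_apply, Wmat_apply ℓ h₁, if_neg fun h => hk (eq_sub_of_add_eq h.symm), map_zero,
      mul_zero]
  · simp
end

section
/- Let d, M ≥ 1, let ρ_0,…,ρ_{M−1} be density matrices on ℂ^d, and let Y_0,…,Y_{M−1} be positive semidefinite Hermitian d×d complex matrices with Σ_{w} Y_w ≤ I (in the Loewner order). Then for every s ∈ (0,1), the average success probability p := (1/M)·Σ_{w=0}^{M−1} Tr(ρ_w Y_w) satisfies p ≤ (d/M)^{s/(1+s)}. (This is the strong converse bound 1 − P_err ≤ (dim/M)^{s/(1+s)} for QPIR, valid for any error probability and without any secrecy condition.) -/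
open Matrix
open scoped ComplexOrder

open scoped MatrixOrder

attribute [local instance] Matrix.frobeniusNormedAddCommGroup

namespace Matrix

variable {n : Type*} [Fintype n]

lemma frobenius_norm_sq_eq_re_trace (A : Matrix n n ℂ) : ‖A‖ ^ 2 = (Aᴴ * A).trace.re := by
  rw [frobenius_norm_def, ← Real.sqrt_eq_rpow, Real.sq_sqrt (by positivity), trace, Complex.re_sum,
    Finset.sum_comm]
  refine Finset.sum_congr rfl fun j _ => ?_
  rw [diag_apply, mul_apply, Complex.re_sum]
  refine Finset.sum_congr rfl fun i _ => ?_
  rw [conjTranspose_apply, Complex.star_def, ← Complex.normSq_eq_conj_mul_self,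
    Complex.ofReal_re, Complex.normSq_eq_norm_sq, Real.rpow_two]

namespace PosSemidef

variable [DecidableEq n] {A B : Matrix n n ℂ}

lemma exists_eq_conjTranspose_mul_self (hA : A.PosSemidef) : ∃ C : Matrix n n ℂ, A = Cᴴ * C :=
  CStarAlgebra.nonneg_iff_eq_star_mul_self.mp hA.nonneg

lemma re_trace_mul_mem_Icc (hA : A.PosSemidef) (hB : B.PosSemidef) :
    (A * B).trace.re ∈ Set.Icc 0 (A.trace.re * B.trace.re) := by
  obtain ⟨X, rfl⟩ := hA.exists_eq_conjTranspose_mul_self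
  obtain ⟨Z, rfl⟩ := hB.exists_eq_conjTranspose_mul_self
  have h : (Xᴴ * X * (Zᴴ * Z)).trace.re = ‖X * Zᴴ‖ ^ 2 := by
    rw [frobenius_norm_sq_eq_re_trace, conjTranspose_mul, conjTranspose_conjTranspose,
      ← Matrix.mul_assoc, trace_mul_comm]
    simp only [Matrix.mul_assoc]
  rw [h, ← frobenius_norm_sq_eq_re_trace, ← frobenius_norm_sq_eq_re_trace, ← mul_pow]
  refine ⟨by positivity, ?_⟩
  gcongr
  simpa using frobenius_norm_mul X Zᴴ

end PosSemidef

end Matrix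

/-- Strong converse bound for QPIR: for density matrices `ρ_w` on `ℂ^d` and a sub-POVM
`{Y_w}`, for every `s ∈ (0,1)` the average success probability
`p = (1/M) Σ_w Tr(ρ_w Y_w)` satisfies `p ≤ (d/M)^{s/(1+s)}`. -/
theorem qpir_strong_converse (d M : ℕ) (hd : 1 ≤ d) (hM : 1 ≤ M)
    (ρ : Fin M → Matrix (Fin d) (Fin d) ℂ)
    (hρ : ∀ w, (ρ w).PosSemidef) (htr : ∀ w, (ρ w).trace = 1)
    (Y : Fin M → Matrix (Fin d) (Fin d) ℂ)
    (hY : ∀ w, (Y w).PosSemidef)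
    (hYle : ((1 : Matrix (Fin d) (Fin d) ℂ) - ∑ w, Y w).PosSemidef)
    (s : ℝ) (hs : s ∈ Set.Ioo (0 : ℝ) 1) :
    (M : ℝ)⁻¹ * ∑ w, ((ρ w * Y w).trace).re ≤ ((d : ℝ) / M) ^ (s / (1 + s)) := by
  have hM' : (0 : ℝ) < M := by exact_mod_cast hM
  have hd' : (0 : ℝ) < d := by exact_mod_cast hd
  set p := (M : ℝ)⁻¹ * ∑ w, ((ρ w * Y w).trace).re with hp
  have hρ_re (w) : (ρ w).trace.re = 1 := by rw [htr, Complex.one_re]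
  have hY_le_one (w) : ((1 : Matrix (Fin d) (Fin d) ℂ) - Y w).PosSemidef :=
    le_iff.mp <| (Finset.single_le_sum (fun v _ => (hY v).nonneg) (Finset.mem_univ w)).trans
      (le_iff.mpr hYle)
  have h_one : p ≤ 1 := by
    have h : ∑ w, ((ρ w * Y w).trace).re ≤ ∑ _w : Fin M, (1 : ℝ) := by
      refine Finset.sum_le_sum fun w _ => ?_
      have := ((hρ w).re_trace_mul_mem_Icc (hY_le_one w)).1
      rwa [Matrix.mul_sub, Matrix.mul_one, trace_sub, Complex.sub_re, hρ_re, sub_nonneg] at this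
    rw [hp, inv_mul_le_iff₀ hM']
    simpa using h
  have h_dim : p ≤ d / M := by
    have h : ∑ w, ((ρ w * Y w).trace).re ≤ ∑ w, (Y w).trace.re :=
      Finset.sum_le_sum fun w _ => by
        simpa [hρ_re] using ((hρ w).re_trace_mul_mem_Icc (hY w)).2
    have htrace := (Complex.nonneg_iff.mp hYle.trace_nonneg).1
    rw [trace_sub, trace_sum, trace_one, Complex.sub_re, Complex.re_sum, Fintype.card_fin,
      Complex.natCast_re, sub_nonneg] at htrace
    rw [hp, inv_mul_eq_div]
    gcongr
    exact h.trans htrace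
  have hs0 : 0 < s := hs.1
  rcases le_total ((d : ℝ) / M) 1 with h | h
  · exact h_dim.trans <| Real.self_le_rpow_of_le_one (by positivity) h <|
      (div_le_one (by positivity)).mpr (by linarith)
  · exact h_one.trans <| Real.one_le_rpow h (by positivity)
end

section
/- Let d, M ≥ 1, let ρ_0,…,ρ_{M−1} be density matrices on ℂ^d, suppose σ := (1/M)·Σ_w ρ_w is positive definite, and let s ∈ (0,1). Then (1/M)·Σ_{w=0}^{M−1} Tr(ρ_w^{1+s} · σ^{−s}) ≤ Tr(σ^{1−s}) ≤ d^s, where matrix powers of the positive semidefinite matrices ρ_w and the positive definite matrix σ are defined by applying the real power functions t ↦ t^{1+s}, t ↦ t^{−s}, t ↦ t^{1−s} to the eigenvalues in a spectral decomposition (Hermitian functional calculus). -/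
open Matrix
open scoped ComplexOrder

/-- Hermitian functional calculus: `A^r` obtained by applying the real power `t ↦ t^r`
to the eigenvalues in a spectral decomposition of the Hermitian matrix `A`. -/
noncomputable def hermPow {d : ℕ} {A : Matrix (Fin d) (Fin d) ℂ} (hA : A.IsHermitian)
    (r : ℝ) : Matrix (Fin d) (Fin d) ℂ :=
  (hA.eigenvectorUnitary : Matrix (Fin d) (Fin d) ℂ) *
    Matrix.diagonal (fun i => ((hA.eigenvalues i ^ r : ℝ) : ℂ)) *
    star (hA.eigenvectorUnitary : Matrix (Fin d) (Fin d) ℂ)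

section

variable {d : ℕ} {A B : Matrix (Fin d) (Fin d) ℂ}

theorem hermPow_one (hA : A.IsHermitian) : hermPow hA 1 = A := by
  conv_rhs => rw [hA.spectral_theorem]
  simp [hermPow, Unitary.conjStarAlgAut_apply, Function.comp_def]

theorem hermPow_mul_hermPow (hA : A.PosDef) (r t : ℝ) :
    hermPow hA.1 r * hermPow hA.1 t = hermPow hA.1 (r + t) := by
  have hU : star (hA.1.eigenvectorUnitary : Matrix (Fin d) (Fin d) ℂ) *
      (hA.1.eigenvectorUnitary : Matrix (Fin d) (Fin d) ℂ) = 1 :=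
    Unitary.coe_star_mul_self _
  simp only [hermPow, Matrix.mul_assoc]
  rw [← Matrix.mul_assoc (star _) (hA.1.eigenvectorUnitary : Matrix (Fin d) (Fin d) ℂ), hU,
    Matrix.one_mul, ← Matrix.mul_assoc (diagonal _) (diagonal _), diagonal_mul_diagonal]
  simp only [← Complex.ofReal_mul, ← Real.rpow_add (hA.eigenvalues_pos _)]

theorem trace_hermPow (hA : A.IsHermitian) (r : ℝ) :
    (hermPow hA r).trace = ((∑ i, hA.eigenvalues i ^ r : ℝ) : ℂ) := by
  have hU : star (hA.eigenvectorUnitary : Matrix (Fin d) (Fin d) ℂ) *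
      (hA.eigenvectorUnitary : Matrix (Fin d) (Fin d) ℂ) = 1 :=
    Unitary.coe_star_mul_self _
  rw [hermPow, Matrix.trace_mul_comm, ← Matrix.mul_assoc, hU, Matrix.one_mul, trace_diagonal]
  push_cast
  rfl

theorem posSemidef_hermPow (hA : A.PosSemidef) (r : ℝ) : (hermPow hA.1 r).PosSemidef := by
  refine PosSemidef.mul_mul_conjTranspose_same (PosSemidef.diagonal fun i => ?_) _
  exact Complex.zero_le_real.2 (Real.rpow_nonneg (hA.eigenvalues_nonneg i) r)

theorem sum_eigenvalues_eq_one (hA : A.IsHermitian) (htr : A.trace = 1) :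
    ∑ i, hA.eigenvalues i = 1 := by
  have h := hA.trace_eq_sum_eigenvalues
  rw [htr] at h
  exact Complex.ofReal_injective (by push_cast; exact h.symm)

theorem posSemidef_sub_hermPow (hA : A.PosSemidef) (htr : A.trace = 1) {r : ℝ} (hr : 1 ≤ r) :
    (A - hermPow hA.1 r).PosSemidef := by
  nth_rewrite 1 [← hermPow_one hA.1]
  rw [hermPow, hermPow, ← Matrix.sub_mul, ← Matrix.mul_sub, diagonal_sub]
  refine PosSemidef.mul_mul_conjTranspose_same (PosSemidef.diagonal fun i => ?_) _
  have h0 := hA.eigenvalues_nonneg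
  have h1 : hA.1.eigenvalues i ≤ 1 := by
    rw [← sum_eigenvalues_eq_one hA.1 htr]
    exact Finset.single_le_sum (fun j _ => h0 j) (Finset.mem_univ i)
  rw [Pi.zero_apply, ← Complex.ofReal_sub, Complex.zero_le_real, sub_nonneg]
  exact Real.rpow_le_rpow_of_exponent_ge_of_imp (h0 i) h1 hr (by intros; linarith)

open scoped MatrixOrder Matrix.Norms.L2Operator in
theorem Matrix.PosSemidef.re_trace_mul_nonneg (hA : A.PosSemidef) (hB : B.PosSemidef) :
    0 ≤ ((A * B).trace).re := by
  obtain ⟨C, rfl⟩ := CStarAlgebra.nonneg_iff_eq_star_mul_self.1 hB.nonneg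
  rw [← Matrix.mul_assoc, Matrix.trace_mul_comm, ← Matrix.mul_assoc]
  exact (Complex.nonneg_iff.1 (hA.mul_mul_conjTranspose_same C).trace_nonneg).1

theorem re_trace_hermPow_le (hA : A.PosSemidef) (htr : A.trace = 1) (hd : 1 ≤ d)
    {s : ℝ} (hs : s ∈ Set.Icc (0 : ℝ) 1) :
    ((hermPow hA.1 (1 - s)).trace).re ≤ (d : ℝ) ^ s := by
  rw [trace_hermPow, Complex.ofReal_re]
  have hd0 : (0 : ℝ) < d := by exact_mod_cast hd
  have h := (Real.concaveOn_rpow (p := 1 - s) (by linarith [hs.2]) (by linarith [hs.1])).le_map_sum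
    (t := Finset.univ) (w := fun _ : Fin d => (d : ℝ)⁻¹) (p := hA.1.eigenvalues)
    (fun _ _ => by positivity) (by simp [hd0.ne']) (fun i _ => hA.eigenvalues_nonneg i)
  simp only [smul_eq_mul, ← Finset.mul_sum, sum_eigenvalues_eq_one hA.1 htr, mul_one] at h
  have hpow : (d : ℝ) / (d : ℝ) ^ (1 - s) = (d : ℝ) ^ s := by
    rw [div_eq_iff (by positivity), ← Real.rpow_add hd0, add_sub_cancel, Real.rpow_one]
  rwa [inv_mul_le_iff₀ hd0, Real.inv_rpow hd0.le, ← div_eq_mul_inv, hpow] at h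

end

/-- For density matrices `ρ_w` with positive definite average `σ = (1/M) Σ_w ρ_w` and
`s ∈ (0,1)`: `(1/M) Σ_w Tr(ρ_w^{1+s} σ^{−s}) ≤ Tr(σ^{1−s}) ≤ d^s`. -/
theorem renyi_trace_bound (d M : ℕ) (hd : 1 ≤ d) (hM : 1 ≤ M)
    (ρ : Fin M → Matrix (Fin d) (Fin d) ℂ)
    (hρ : ∀ w, (ρ w).PosSemidef) (htr : ∀ w, (ρ w).trace = 1)
    (s : ℝ) (hs : s ∈ Set.Ioo (0 : ℝ) 1)
    (σ : Matrix (Fin d) (Fin d) ℂ) (hσdef : σ = (M : ℂ)⁻¹ • ∑ w, ρ w)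
    (hσ : σ.PosDef) :
    ((M : ℝ)⁻¹ * ∑ w,
        ((hermPow (hρ w).1 (1 + s) * hermPow hσ.1 (-s)).trace).re ≤
      ((hermPow hσ.1 (1 - s)).trace).re) ∧
    ((hermPow hσ.1 (1 - s)).trace).re ≤ (d : ℝ) ^ s := by
  have hM0 : (M : ℂ) ≠ 0 := by exact_mod_cast (by omega : M ≠ 0)
  constructor
  · have hσpow : ((hermPow hσ.1 (1 - s)).trace).re =
        (M : ℝ)⁻¹ * ∑ w, ((ρ w * hermPow hσ.1 (-s)).trace).re := by
      have hmul : hermPow hσ.1 (1 - s) = ((M : ℂ)⁻¹ • ∑ w, ρ w) * hermPow hσ.1 (-s) := by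
        rw [sub_eq_add_neg, ← hermPow_mul_hermPow hσ, hermPow_one, ← hσdef]
      rw [hmul, Matrix.smul_mul, Matrix.sum_mul, trace_smul, trace_sum, smul_eq_mul,
        ← Complex.ofReal_natCast, ← Complex.ofReal_inv, Complex.re_ofReal_mul, Complex.re_sum]
    rw [hσpow]
    refine mul_le_mul_of_nonneg_left (Finset.sum_le_sum fun w _ => ?_) (by positivity)
    have h := (posSemidef_sub_hermPow (hρ w) (htr w)
      (by linarith [hs.1] : 1 ≤ 1 + s)).re_trace_mul_nonneg
      (posSemidef_hermPow hσ.posSemidef (-s))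
    rwa [Matrix.sub_mul, trace_sub, Complex.sub_re, sub_nonneg] at h
  · refine re_trace_hermPow_le hσ.posSemidef ?_ hd (Set.Ioo_subset_Icc_self hs)
    rw [hσdef, trace_smul, trace_sum]
    simp [htr, hM0]
end
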